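/- Let L ≥ 1 and let l_1, …, l_L be finite sequences of positive real numbers. Then ḡ(l_1 ⧺ l_2 ⧺ ⋯ ⧺ l_L) ≤ ∏_{a=1}^{L} ḡ(l_a), where ⧺ denotes concatenation of finite sequences. -/

import Mathlib

/-- `g(x) = max{x, 1/x}`. -/
noncomputable def gfun (x : ℝ) : ℝ := max x x⁻¹

/-- The squeezing parameter `ḡ` of a finite sequence of squeezing strengths:
the maximum of `g` over the products of all contiguous subsequences
(with the convention `ḡ = 1` for the empty sequence, realized by the empty
contiguous subsequence). -/
noncomputable def gbar (l : List ℝ) : ℝ :=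
  sSup {x : ℝ | ∃ l₁ l₂ l₃ : List ℝ, l = l₁ ++ l₂ ++ l₃ ∧ x = gfun l₂.prod}


theorem bddAbove_gfun_prod_infix (l : List ℝ) :
    BddAbove {x : ℝ | ∃ l₁ l₂ l₃ : List ℝ, l = l₁ ++ l₂ ++ l₃ ∧ x = gfun l₂.prod} := by
  refine Set.Finite.bddAbove
    (((List.finite_toSet l.sublists).image fun m => gfun m.prod).subset ?_)
  rintro x ⟨l₁, l₂, l₃, h, rfl⟩
  refine ⟨l₂, ?_, rfl⟩
  have hs : l₂ <:+: l := ⟨l₁, l₃, h.symm⟩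
  simpa using hs.sublist

theorem gfun_prod_le_gbar {l m : List ℝ} (h : m <:+: l) : gfun m.prod ≤ gbar l := by
  obtain ⟨l₁, l₃, h⟩ := h
  exact le_csSup (bddAbove_gfun_prod_infix l) ⟨l₁, m, l₃, h.symm, rfl⟩

theorem gbar_le {l : List ℝ} {c : ℝ} (h : ∀ m, m <:+: l → gfun m.prod ≤ c) : gbar l ≤ c := by
  refine csSup_le ⟨_, [], [], l, rfl, rfl⟩ ?_
  rintro x ⟨l₁, l₂, l₃, hl, rfl⟩
  exact h l₂ ⟨l₁, l₃, hl.symm⟩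

theorem one_le_gbar (l : List ℝ) : 1 ≤ gbar l := by
  simpa [gfun] using gfun_prod_le_gbar (List.nil_infix : [] <:+: l)

theorem gbar_nil : gbar [] = 1 := by
  refine le_antisymm (gbar_le fun m hm => ?_) (one_le_gbar [])
  rw [List.infix_nil.mp hm]
  simp [gfun]

theorem gfun_nonneg {x : ℝ} (hx : 0 < x) : 0 ≤ gfun x := hx.le.trans (le_max_left _ _)

theorem gfun_mul_le {x y : ℝ} (hx : 0 < x) (hy : 0 < y) : gfun (x * y) ≤ gfun x * gfun y := by
  refine max_le ?_ ?_
  · exact mul_le_mul (le_max_left _ _) (le_max_left _ _) hy.le (gfun_nonneg hx)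
  · rw [mul_inv]
    exact mul_le_mul (le_max_right _ _) (le_max_right _ _) (inv_pos.mpr hy).le (gfun_nonneg hx)

theorem exists_append_of_infix_append {α : Type*} {m k l : List α} (h : m <:+: k ++ l) :
    ∃ m₁ m₂, m = m₁ ++ m₂ ∧ m₁ <:+: k ∧ m₂ <:+: l := by
  rcases List.infix_append_iff.mp h with h | h | ⟨m₁, m₂, h, h₁, h₂⟩
  · exact ⟨m, [], by simp, h, List.nil_infix⟩
  · exact ⟨[], m, by simp, List.nil_infix, h⟩
  · exact ⟨m₁, m₂, h, h₁.isInfix, h₂.isInfix⟩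

theorem gbar_append_le {k l : List ℝ} (hk : ∀ x ∈ k, 0 < x) (hl : ∀ x ∈ l, 0 < x) :
    gbar (k ++ l) ≤ gbar k * gbar l := by
  refine gbar_le fun m hm => ?_
  obtain ⟨m₁, m₂, rfl, h₁, h₂⟩ := exists_append_of_infix_append hm
  have p₁ : 0 < m₁.prod := List.prod_pos fun x hx => hk x (h₁.subset hx)
  have p₂ : 0 < m₂.prod := List.prod_pos fun x hx => hl x (h₂.subset hx)
  rw [List.prod_append]
  exact (gfun_mul_le p₁ p₂).trans (mul_le_mul (gfun_prod_le_gbar h₁) (gfun_prod_le_gbar h₂)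
    (gfun_nonneg p₂) (zero_le_one.trans (one_le_gbar k)))

theorem gbar_flatten_le (ls : List (List ℝ)) (h : ∀ l ∈ ls, ∀ x ∈ l, 0 < x) :
    gbar ls.flatten ≤ (ls.map gbar).prod := by
  induction ls with
  | nil => simp [gbar_nil]
  | cons l ls ih =>
    rw [List.forall_mem_cons] at h
    rw [List.flatten_cons, List.map_cons, List.prod_cons]
    refine (gbar_append_le h.1 fun x hx => ?_).trans
      (mul_le_mul_of_nonneg_left (ih h.2) (zero_le_one.trans (one_le_gbar l)))
    obtain ⟨m, hm, hx⟩ := List.mem_flatten.mp hx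
    exact h.2 m hm x hx

/-- Lemma C.8, first bound: the squeezing parameter of a concatenated circuit is at most
the product of the squeezing parameters of its subcircuits:
`ḡ(l_1 ⧺ ⋯ ⧺ l_L) ≤ ∏_a ḡ(l_a)`. -/
theorem gbar_join_le_prod (L : ℕ) (hL : 1 ≤ L) (l : Fin L → List ℝ)
    (hpos : ∀ a, ∀ x ∈ l a, 0 < x) :
    gbar (List.ofFn l).flatten ≤ ∏ a, gbar (l a) := by
  have h := gbar_flatten_le (List.ofFn l) (by simpa [List.mem_ofFn] using hpos)
  rwa [List.map_ofFn, List.prod_ofFn] at h
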